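/- Let G be a discrete group and L a length function on G. Fix r > 0, and let E ⊆ B(r) and F ⊆ G \ B(2r) be finite subsets; set k = χ_E and h = χ_F. Then for every finitely supported f : G → ℂ one has ‖λ_{(h*∗k)·f}‖ ≤ r⁻¹ · |E|^{1/2} · |F|^{1/2} · J_D(f) and J_D((h*∗k)·f) ≤ |E|^{1/2} · |F|^{1/2} · J_D(f), where (h*∗k)·f denotes the pointwise product of the convolution h*∗k with f. -/

import Mathlib

open scoped ENNReal ComplexConjugate

noncomputable section

variable {G : Type*}

/-- The Hilbert space `ℓ²(G)` of square-summable complex-valued functions on `G`. -/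
abbrev l2 (G : Type*) : Type _ := lp (fun _ : G => ℂ) 2

variable [Group G]

/-- A length function on a group `G`: subadditive, symmetric under inverses,
and vanishing exactly at the identity. -/
structure IsLengthFunction (L : G → ℝ) : Prop where
  nonneg : ∀ x, 0 ≤ L x
  subadd : ∀ x y, L (x * y) ≤ L x + L y
  inv_eq : ∀ x, L x⁻¹ = L x
  eq_zero_iff : ∀ x, L x = 0 ↔ x = 1

/-- The ball `B(r) = {x ∈ G : L x ≤ r}`. -/
def lball (L : G → ℝ) (r : ℝ) : Set G := {x : G | L x ≤ r}

/-- A length function is proper if all balls are finite. -/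
def IsProperLF (L : G → ℝ) : Prop := ∀ r : ℝ, (lball L r).Finite

/-- Bounded doubling: `L` is proper and there is `C < ∞` with
`|B(2r)| ≤ C |B(r)|` for all `r ≥ 1`. -/
def HasBoundedDoubling (L : G → ℝ) : Prop :=
  IsProperLF L ∧ ∃ C : ℝ, ∀ r : ℝ, 1 ≤ r →
    ((lball L (2 * r)).ncard : ℝ) ≤ C * ((lball L r).ncard : ℝ)

/-- `T` is the convolution operator `λ_f`, `(λ_f ξ)(x) = Σ_y f(xy⁻¹) ξ(y)`. -/
def IsConvOp (f : G → ℂ) (T : l2 G →L[ℂ] l2 G) : Prop :=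
  ∀ (ξ : l2 G) (x : G), T ξ x = ∑' y : G, f (x * y⁻¹) * ξ y

/-- `T` is the commutator `[D, λ_f]` for `D = M_L`, i.e.
`([D,λ_f] ξ)(x) = Σ_y (L x − L y) f(xy⁻¹) ξ(y)`. -/
def IsCommOp (L : G → ℝ) (f : G → ℂ) (T : l2 G →L[ℂ] l2 G) : Prop :=
  ∀ (ξ : l2 G) (x : G), T ξ x = ∑' y : G, ((L x : ℂ) - (L y : ℂ)) * f (x * y⁻¹) * ξ y

/-- `T` is the truncated operator `(I − M_{2r}) λ_f M_r`. -/
def IsTruncOp (L : G → ℝ) (f : G → ℂ) (r : ℝ) (T : l2 G →L[ℂ] l2 G) : Prop :=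
  ∀ (ξ : l2 G) (x : G),
    T ξ x = if L x ≤ 2 * r then 0
      else ∑' y : G, (if L y ≤ r then f (x * y⁻¹) * ξ y else 0)

/-- The seminorm `J_D(f) = sup_{r>0} r ‖(I − M_{2r}) λ_f M_r‖`. -/
def JD (L : G → ℝ) (f : G → ℂ) : ℝ :=
  sSup {a : ℝ | ∃ r : ℝ, 0 < r ∧ ∃ T : l2 G →L[ℂ] l2 G, IsTruncOp L f r T ∧ a = r * ‖T‖}

/-- The convolution `h* ∗ k`, where `h*(z) = conj (h z⁻¹)`. -/
def starConv (h k : G → ℂ) : G → ℂ :=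
  fun x => ∑' z : G, conj (h z⁻¹) * k (z⁻¹ * x)

/-- The `ℓ²` norm `‖h‖₂ = (Σ_x |h x|²)^{1/2}` of a function `h : G → ℂ`. -/
def l2norm (h : G → ℂ) : ℝ := Real.sqrt (∑' x : G, ‖h x‖ ^ 2)

lemma l2_enorm_sq {X : Type*} (ξ : l2 X) : ‖ξ‖ₑ ^ 2 = ∑' x, ‖ξ x‖ₑ ^ 2 := by
  have h := lp.norm_rpow_eq_tsum (p := 2) (by simp) ξ
  have hs := (memℓp_gen_iff (by simp)).1 (lp.memℓp ξ)
  simp only [ENNReal.toReal_ofNat, Real.rpow_ofNat] at h hs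
  rw [← ofReal_norm, ← ENNReal.ofReal_pow (norm_nonneg _), h,
    ENNReal.ofReal_tsum_of_nonneg (fun _ => by positivity) hs]
  exact tsum_congr fun x => by rw [ENNReal.ofReal_pow (norm_nonneg _), ofReal_norm]

/-- The contraction `ξ ↦ χ_S · (ξ ∘ σ)` of `ℓ²(X)`, for an injective self-map `σ` of `X`. -/
def l2Compression {X : Type*} (S : Set X) (σ : X → X) (hσ : σ.Injective) : l2 X →L[ℂ] l2 X :=
  LinearMap.mkContinuous
    { toFun := fun ξ => ⟨S.indicator (fun x => ξ (σ x)), by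
        have h : Summable fun x => ‖ξ (σ x)‖ ^ 2 := by
          have := (memℓp_gen_iff (by simp)).1 (lp.memℓp ξ)
          simp only [ENNReal.toReal_ofNat, Real.rpow_ofNat] at this
          exact this.comp_injective hσ
        refine memℓp_gen (h.of_nonneg_of_le (fun x => by positivity) fun x => ?_)
        simp only [ENNReal.toReal_ofNat, Real.rpow_ofNat]
        gcongr
        exact norm_indicator_le_norm_self (fun x => ξ (σ x)) x⟩
      map_add' := fun ξ η => lp.ext (Set.indicator_add S _ _)
      map_smul' := fun c ξ => lp.ext (Set.indicator_const_smul S c _) }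
    1 fun ξ => by
      rw [one_mul, ← enorm_le_iff_norm_le, ← ENNReal.pow_le_pow_left_iff two_ne_zero,
        l2_enorm_sq, l2_enorm_sq]
      refine le_trans (ENNReal.tsum_le_tsum fun x => ?_)
        (ENNReal.tsum_comp_le_tsum_of_injective hσ fun x => ‖ξ x‖ₑ ^ 2)
      gcongr
      exact enorm_indicator_le_enorm_self (fun x => ξ (σ x)) x

lemma l2Compression_apply {X : Type*} (S : Set X) (σ : X → X) (hσ : σ.Injective) (ξ : l2 X)
    (x : X) : l2Compression S σ hσ ξ x = S.indicator (fun x => ξ (σ x)) x := rfl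

lemma norm_l2Compression_le {X : Type*} (S : Set X) (σ : X → X) (hσ : σ.Injective) :
    ‖l2Compression S σ hσ‖ ≤ 1 :=
  LinearMap.mkContinuous_norm_le _ zero_le_one _

lemma finite_support_convolution (f : G →₀ ℂ) (x : G) (u : G → ℂ) :
    (Function.support fun y => f (x * y⁻¹) * u y).Finite := by
  have hinj : Function.Injective fun y : G => x * y⁻¹ := fun a b h => by simpa using h
  refine ((f.support.finite_toSet).preimage hinj.injOn).subset fun y hy => ?_
  simpa using left_ne_zero_of_mul hy

lemma tsum_convolution_eq_sum (f : G →₀ ℂ) (x : G) (u : G → ℂ) :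
    ∑' y, f (x * y⁻¹) * u y = ∑ z ∈ f.support, f z * u (z⁻¹ * x) := by
  rw [← ((Equiv.inv G).trans (Equiv.mulRight x)).tsum_eq]
  rw [tsum_eq_sum (s := f.support)]
  · simp
  · intro z hz
    simp [Finsupp.notMem_support_iff.1 hz]

lemma exists_isTruncOp {L : G → ℝ} (hL : IsLengthFunction L) (f : G →₀ ℂ) {r : ℝ} (hr : 0 < r) :
    ∃ T : l2 G →L[ℂ] l2 G, IsTruncOp L f r T ∧ r * ‖T‖ ≤ ∑ z ∈ f.support, ‖f z‖ * L z := by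
  let C (z : G) : l2 G →L[ℂ] l2 G :=
    l2Compression {x | ¬ L x ≤ 2 * r ∧ L (z⁻¹ * x) ≤ r} (z⁻¹ * ·) (mul_right_injective _)
  refine ⟨∑ z ∈ f.support, f z • C z, fun ξ x => ?_, ?_⟩
  · have h1 : (∑ z ∈ f.support, f z • C z) ξ x = ∑ z ∈ f.support, f z * C z ξ x := by
      rw [sum_apply, lp.coeFn_sum, Finset.sum_apply]
      rfl
    simp only [← mul_ite_zero, tsum_convolution_eq_sum, h1, C, l2Compression_apply,
      Set.indicator_apply, Set.mem_ofPred_eq]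
    split_ifs with hx <;> simp only [hx, not_true, not_false_eq_true, true_and, false_and,
      if_false, mul_zero, Finset.sum_const_zero]
  · have hC (z : G) : r * ‖C z‖ ≤ L z := by
      by_cases hz : L z ≤ r
      · have h0 : C z = 0 := by
          ext ξ x
          rw [l2Compression_apply]
          refine Set.indicator_of_notMem (fun hx => ?_) _
          rw [Set.mem_ofPred_eq] at hx
          refine hx.1 ?_
          have := hL.subadd z (z⁻¹ * x)
          rw [mul_inv_cancel_left] at this
          linarith [hx.2]
        simpa [h0] using hL.nonneg z
      · nlinarith [norm_l2Compression_le {x | ¬ L x ≤ 2 * r ∧ L (z⁻¹ * x) ≤ r} (z⁻¹ * ·)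
          (mul_right_injective _)]
    calc r * ‖∑ z ∈ f.support, f z • C z‖ ≤ r * ∑ z ∈ f.support, ‖f z • C z‖ := by
          gcongr; exact norm_sum_le _ _
      _ = ∑ z ∈ f.support, ‖f z‖ * (r * ‖C z‖) := by
          rw [Finset.mul_sum]
          exact Finset.sum_congr rfl fun z _ => by rw [norm_smul]; ring
      _ ≤ _ := by gcongr with z; exact hC z

lemma IsTruncOp.unique {L : G → ℝ} {f : G → ℂ} {r : ℝ} {S T : l2 G →L[ℂ] l2 G}
    (hS : IsTruncOp L f r S) (hT : IsTruncOp L f r T) : S = T := by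
  ext ξ x
  rw [hS, hT]

lemma IsTruncOp.mul_norm_le_JD {L : G → ℝ} (hL : IsLengthFunction L) {f : G →₀ ℂ} {r : ℝ}
    (hr : 0 < r) {T : l2 G →L[ℂ] l2 G} (hT : IsTruncOp L f r T) : r * ‖T‖ ≤ JD L f := by
  refine le_csSup ⟨∑ z ∈ f.support, ‖f z‖ * L z, ?_⟩ ⟨r, hr, T, hT, rfl⟩
  rintro _ ⟨s, hs, S, hS, rfl⟩
  obtain ⟨S', hS', hle⟩ := exists_isTruncOp hL f hs
  rwa [hS.unique hS']

lemma JD_nonneg (L : G → ℝ) (f : G → ℂ) : 0 ≤ JD L f := by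
  refine Real.sSup_nonneg ?_
  rintro _ ⟨s, hs, S, -, rfl⟩
  positivity

/-- The multiplication operator by the indicator function of `{y | h * y⁻¹ ∈ E}`. -/
def l2Cutoff (E : Finset G) (h : G) : l2 G →L[ℂ] l2 G :=
  l2Compression {y | h * y⁻¹ ∈ E} id Function.injective_id

lemma l2Cutoff_apply [DecidableEq G] (E : Finset G) (h : G) (ξ : l2 G) (y : G) :
    l2Cutoff E h ξ y = (if h * y⁻¹ ∈ E then 1 else 0) * ξ y := by
  simp [l2Cutoff, l2Compression_apply, Set.indicator_apply]

lemma tsum_enorm_sq_l2Cutoff (E : Finset G) (ξ : l2 G) :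
    ∑' h, ‖l2Cutoff E h ξ‖ₑ ^ 2 = E.card * ‖ξ‖ₑ ^ 2 := by
  classical
  simp only [l2_enorm_sq]
  rw [ENNReal.tsum_comm, ← ENNReal.tsum_mul_left]
  refine tsum_congr fun y => ?_
  rw [← (Equiv.mulRight y).tsum_eq, tsum_eq_sum (s := E)]
  · rw [Finset.sum_congr rfl (g := fun _ => ‖ξ y‖ₑ ^ 2) fun h hh => by simp [l2Cutoff_apply, hh]]
    simp
  · intro h hh
    simp [l2Cutoff_apply, hh]

/-- A Schur multiplier estimate for sums of operators localized by translates of `E` and `F`. -/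
lemma norm_le_of_eq_sum_l2Cutoff (E F : Finset G) {a : ℝ} (ha : 0 ≤ a)
    (A : G → l2 G →L[ℂ] l2 G) (hA : ∀ h, ‖A h‖ ≤ a) (T : l2 G →L[ℂ] l2 G)
    (hT : ∀ ξ x, T ξ x = ∑ w ∈ F, A (w * x) (l2Cutoff E (w * x) ξ) x) :
    ‖T‖ ≤ Real.sqrt E.card * Real.sqrt F.card * a := by
  refine T.opNorm_le_bound (by positivity) fun ξ => ?_
  have key : ‖T ξ‖ₑ ^ 2 ≤ F.card * (ENNReal.ofReal a ^ 2 * (E.card * ‖ξ‖ₑ ^ 2)) := by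
    calc ‖T ξ‖ₑ ^ 2 = ∑' x, ‖T ξ x‖ₑ ^ 2 := l2_enorm_sq _
      _ ≤ ∑' x, F.card * ∑' h, ‖A h (l2Cutoff E h ξ) x‖ₑ ^ 2 := by
        refine ENNReal.tsum_le_tsum fun x => ?_
        calc ‖T ξ x‖ₑ ^ 2 ≤ (∑ w ∈ F, ‖A (w * x) (l2Cutoff E (w * x) ξ) x‖ₑ) ^ 2 := by
              rw [hT]; gcongr; exact enorm_sum_le _ _
          _ ≤ F.card * ∑ w ∈ F, ‖A (w * x) (l2Cutoff E (w * x) ξ) x‖ₑ ^ 2 := by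
              have hr : ∀ w, ‖A (w * x) (l2Cutoff E (w * x) ξ) x‖ₑ =
                  (‖A (w * x) (l2Cutoff E (w * x) ξ) x‖₊ : ℝ≥0∞) := fun _ => rfl
              simp only [hr]
              norm_cast
              simpa using sq_sum_le_card_mul_sum_sq (s := F)
                (f := fun w => ‖A (w * x) (l2Cutoff E (w * x) ξ) x‖₊)
          _ ≤ _ := by
              gcongr
              refine (ENNReal.sum_le_tsum F).trans ?_
              exact ENNReal.tsum_comp_le_tsum_of_injective (mul_left_injective x)
                fun h => ‖A h (l2Cutoff E h ξ) x‖ₑ ^ 2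
      _ = F.card * ∑' h, ‖A h (l2Cutoff E h ξ)‖ₑ ^ 2 := by
        rw [ENNReal.tsum_mul_left, ENNReal.tsum_comm]
        simp only [l2_enorm_sq]
      _ ≤ F.card * ∑' h, ENNReal.ofReal a ^ 2 * ‖l2Cutoff E h ξ‖ₑ ^ 2 := by
        gcongr with h
        rw [← mul_pow, ← ofReal_norm, ← ofReal_norm, ← ENNReal.ofReal_mul ha]
        gcongr
        exact (A h).le_of_opNorm_le (hA h) _
      _ = _ := by rw [ENNReal.tsum_mul_left, tsum_enorm_sq_l2Cutoff]
  rw [← ofReal_norm, ← ofReal_norm, ← ENNReal.ofReal_pow (norm_nonneg _),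
    ← ENNReal.ofReal_pow (norm_nonneg _), ← ENNReal.ofReal_pow ha, ← ENNReal.ofReal_natCast,
    ← ENNReal.ofReal_natCast, ← ENNReal.ofReal_mul (by positivity),
    ← ENNReal.ofReal_mul (by positivity), ← ENNReal.ofReal_mul (by positivity),
    ENNReal.ofReal_le_ofReal_iff (by positivity)] at key
  refine (sq_le_sq₀ (norm_nonneg _) (by positivity)).1 (key.trans_eq ?_)
  rw [mul_pow, mul_pow, mul_pow, Real.sq_sqrt (by positivity), Real.sq_sqrt (by positivity)]
  ring

lemma starConv_indicator [DecidableEq G] (E F : Finset G) (u : G) :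
    starConv (fun y => if y ∈ F then (1 : ℂ) else 0) (fun y => if y ∈ E then (1 : ℂ) else 0) u =
      ∑ w ∈ F, if w * u ∈ E then 1 else 0 := by
  rw [starConv, ← (Equiv.inv G).tsum_eq, tsum_eq_sum (s := F)]
  · exact Finset.sum_congr rfl fun w hw => by simp [hw]
  · intro w hw
    simp [hw]

lemma tsum_starConv_indicator_mul [DecidableEq G] (E F : Finset G) (f : G →₀ ℂ) (x : G)
    (u : G → ℂ) :
    ∑' y, starConv (fun y => if y ∈ F then (1 : ℂ) else 0)
        (fun y => if y ∈ E then (1 : ℂ) else 0) (x * y⁻¹) * f (x * y⁻¹) * u y =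
      ∑ w ∈ F, ∑' y, f (x * y⁻¹) * ((if w * x * y⁻¹ ∈ E then 1 else 0) * u y) := by
  rw [← Summable.tsum_finsetSum fun w _ =>
    summable_of_hasFiniteSupport (finite_support_convolution f x _)]
  refine tsum_congr fun y => ?_
  rw [starConv_indicator, Finset.sum_mul, Finset.sum_mul]
  exact Finset.sum_congr rfl fun w _ => by rw [mul_assoc w]; ring

/-- The right translation `ξ ↦ ξ (· * h)` of `ℓ²(G)`. -/
def l2RightTranslation (h : G) : l2 G →L[ℂ] l2 G :=
  l2Compression Set.univ (· * h) (mul_left_injective h)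

lemma l2RightTranslation_apply (h : G) (ξ : l2 G) (x : G) :
    l2RightTranslation h ξ x = ξ (x * h) := by
  simp [l2RightTranslation, l2Compression_apply]

lemma norm_l2RightTranslation_le (h : G) : ‖l2RightTranslation h‖ ≤ 1 :=
  norm_l2Compression_le _ _ _

/-- for `E ⊆ B(r)` and `F ⊆ G \ B(2r)` with `k = χ_E`, `h = χ_F`:
`‖λ_{(h*∗k)·f}‖ ≤ r⁻¹ |E|^{1/2} |F|^{1/2} J_D(f)` and
`J_D((h*∗k)·f) ≤ |E|^{1/2} |F|^{1/2} J_D(f)`. -/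
theorem norm_and_JD_indicator_cutoff_le [DecidableEq G]
    (L : G → ℝ) (hL : IsLengthFunction L) (r : ℝ) (hr : 0 < r)
    (E F : Finset G)
    (hE : ∀ x ∈ E, L x ≤ r) (hF : ∀ x ∈ F, ¬ L x ≤ 2 * r)
    (f : G →₀ ℂ) (T : l2 G →L[ℂ] l2 G)
    (hT : IsConvOp (fun x =>
      starConv (fun y => if y ∈ F then (1 : ℂ) else 0)
        (fun y => if y ∈ E then (1 : ℂ) else 0) x * f x) T) :
    ‖T‖ ≤ r⁻¹ * Real.sqrt E.card * Real.sqrt F.card * JD L (f : G → ℂ) ∧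
    JD L (fun x =>
        starConv (fun y => if y ∈ F then (1 : ℂ) else 0)
          (fun y => if y ∈ E then (1 : ℂ) else 0) x * f x) ≤
      Real.sqrt E.card * Real.sqrt F.card * JD L (f : G → ℂ) := by
  constructor
  · obtain ⟨S, hS, -⟩ := exists_isTruncOp hL f hr
    have hbound : ‖T‖ ≤ Real.sqrt E.card * Real.sqrt F.card * ‖S‖ := by
      refine norm_le_of_eq_sum_l2Cutoff E F (norm_nonneg S)
        (fun h => l2RightTranslation h⁻¹ ∘L S ∘L l2RightTranslation h) (fun h => ?_) T
        fun ξ x => ?_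
      · calc _ ≤ ‖l2RightTranslation h⁻¹‖ * (‖S‖ * ‖l2RightTranslation h‖) :=
              (ContinuousLinearMap.opNorm_comp_le _ _).trans (by
                gcongr; exact ContinuousLinearMap.opNorm_comp_le _ _)
          _ ≤ 1 * (‖S‖ * 1) := by gcongr <;> exact norm_l2RightTranslation_le _
          _ = ‖S‖ := by ring
      · rw [hT, tsum_starConv_indicator_mul]
        refine Finset.sum_congr rfl fun w hw => ?_
        have hw' : ¬ L (x * (w * x)⁻¹) ≤ 2 * r := by
          simpa [hL.inv_eq] using hF w hw
        simp only [ContinuousLinearMap.comp_apply, l2RightTranslation_apply]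
        rw [hS, if_neg hw']
        refine Eq.trans (tsum_congr ?_) ((Equiv.mulRight (w * x)⁻¹).tsum_eq _)
        intro y
        simp only [Equiv.coe_mulRight, l2RightTranslation_apply, l2Cutoff_apply,
          inv_mul_cancel_right]
        by_cases hy : w * x * y⁻¹ ∈ E
        · have hle : L (y * (w * x)⁻¹) ≤ r := by
            rw [← hL.inv_eq]
            simpa [mul_assoc] using hE _ hy
          rw [if_pos hle]
          congr 2
          group
        · simp [hy]
    calc ‖T‖ ≤ Real.sqrt E.card * Real.sqrt F.card * ‖S‖ := hbound
      _ = r⁻¹ * Real.sqrt E.card * Real.sqrt F.card * (r * ‖S‖) := by field_simp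
      _ ≤ _ := by gcongr; exact hS.mul_norm_le_JD hL hr
  · refine Real.sSup_le ?_ (mul_nonneg (by positivity) (JD_nonneg _ _))
    rintro _ ⟨s, hs, T', hT', rfl⟩
    obtain ⟨S, hS, -⟩ := exists_isTruncOp hL f hs
    have hbound : ‖T'‖ ≤ Real.sqrt E.card * Real.sqrt F.card * ‖S‖ := by
      refine norm_le_of_eq_sum_l2Cutoff E F (norm_nonneg S) (fun _ => S) (fun _ => le_rfl) T'
        fun ξ x => ?_
      simp only [hT' ξ x, hS _ x]
      split_ifs with hx
      · simp
      · simp only [← mul_ite_zero]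
        rw [tsum_starConv_indicator_mul]
        simp only [l2Cutoff_apply, mul_ite_zero]
    calc s * ‖T'‖ ≤ s * (Real.sqrt E.card * Real.sqrt F.card * ‖S‖) := by gcongr
      _ = Real.sqrt E.card * Real.sqrt F.card * (s * ‖S‖) := by ring
      _ ≤ _ := by gcongr; exact hS.mul_norm_le_JD hL hs
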